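/- Assume d ≥ 3, Ω is irreducible, and the torsion-free group Γ divides Ω. Let F be a flat of Ω and let K be a face of F, namely a nonempty set of the form S ∩ ∂F where S is an affine hyperplane of the affine span of F with S ∩ F = ∅. Then K is a face of Ω. -/

import Mathlib

open Set Filter Metric

noncomputable section

/-- `ℝ^d`. -/
abbrev Euc (d : ℕ) := EuclideanSpace ℝ (Fin d)

/-- A flat of `Ω` with prescribed vertices `v`. -/
def IsFlatWith {d : ℕ} (Ω : Set (Euc d)) (v : Fin d → Euc d) : Prop :=
  AffineIndependent ℝ v ∧
  (∀ j, v j ∈ closure Ω \ Ω) ∧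
  intrinsicInterior ℝ (convexHull ℝ (Set.range v)) ⊆ Ω ∧
  convexHull ℝ (Set.range v) \ intrinsicInterior ℝ (convexHull ℝ (Set.range v)) ⊆ closure Ω \ Ω

/-- A (codimension-one, properly embedded) flat of `Ω`. -/
def IsFlat {d : ℕ} (Ω : Set (Euc d)) (F : Set (Euc d)) : Prop :=
  ∃ v : Fin d → Euc d, IsFlatWith Ω v ∧ F = intrinsicInterior ℝ (convexHull ℝ (Set.range v))

/-- The cone over a subset of `ℝ^d`, inside `ℝ^d × ℝ ≅ ℝ^{d+1}`. -/
def coneOver {d : ℕ} (S : Set (Euc d)) : Set (Euc d × ℝ) :=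
  {p | ∃ t : ℝ, 0 < t ∧ ∃ x ∈ S, p = t • (x, (1 : ℝ))}

/-- Irreducibility of a properly convex domain: its cone admits no direct-sum
decomposition into convex cones. -/
def IsIrreducibleDomain {d : ℕ} (Ω : Set (Euc d)) : Prop :=
  ¬ ∃ (V₁ V₂ : Submodule ℝ (Euc d × ℝ)) (C₁ C₂ : Set (Euc d × ℝ)),
      V₁ ≠ ⊥ ∧ V₂ ≠ ⊥ ∧ V₁ ≠ ⊤ ∧ V₂ ≠ ⊤ ∧ IsCompl V₁ V₂ ∧
      C₁ ⊆ (V₁ : Set (Euc d × ℝ)) ∧ C₂ ⊆ (V₂ : Set (Euc d × ℝ)) ∧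
      Convex ℝ C₁ ∧ Convex ℝ C₂ ∧
      (∀ t : ℝ, 0 < t → ∀ c ∈ C₁, t • c ∈ C₁) ∧
      (∀ t : ℝ, 0 < t → ∀ c ∈ C₂, t • c ∈ C₂) ∧
      coneOver Ω = {p | ∃ c₁ ∈ C₁, ∃ c₂ ∈ C₂, p = c₁ + c₂}

/-- The homeomorphism of `Ω` induced by a linear automorphism of `ℝ^{d+1}`
preserving the cone over `Ω`. -/
def projAct {d : ℕ} (g : (Euc d × ℝ) ≃ₗ[ℝ] (Euc d × ℝ)) (x : Euc d) : Euc d :=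
  ((g (x, 1)).2)⁻¹ • (g (x, 1)).1

/-- `Γ` divides `Ω`: every element preserves the cone over `Ω`; the induced action on `Ω`
is free and properly discontinuous, and admits a compact set whose translates cover `Ω`. -/
def Divides {d : ℕ} (Ω : Set (Euc d))
    (Γ : Subgroup ((Euc d × ℝ) ≃ₗ[ℝ] (Euc d × ℝ))) : Prop :=
  (∀ γ ∈ Γ, (γ : (Euc d × ℝ) ≃ₗ[ℝ] (Euc d × ℝ)) '' coneOver Ω = coneOver Ω) ∧
  (∀ γ ∈ Γ, γ ≠ 1 → ∀ x ∈ Ω, projAct γ x ≠ x) ∧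
  (∀ K : Set (Euc d), K ⊆ Ω → IsCompact K →
    {γ : (Euc d × ℝ) ≃ₗ[ℝ] (Euc d × ℝ) | γ ∈ Γ ∧ (projAct γ '' K ∩ K).Nonempty}.Finite) ∧
  (∃ K : Set (Euc d), K ⊆ Ω ∧ IsCompact K ∧ (⋃ γ ∈ Γ, projAct γ '' K) = Ω)

/-- `Γ` is torsion-free. -/
def TorsionFreeSub {d : ℕ} (Γ : Subgroup ((Euc d × ℝ) ≃ₗ[ℝ] (Euc d × ℝ))) : Prop :=
  ∀ γ ∈ Γ, ∀ n : ℕ, n ≠ 0 → γ ^ n = 1 → γ = 1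

/-- Convergence of a sequence of flats: Hausdorff convergence of their closures. -/
def FlatsConverge {d : ℕ} (Fs : ℕ → Set (Euc d)) (F : Set (Euc d)) : Prop :=
  Tendsto (fun i => hausdorffDist (closure (Fs i)) (closure F)) atTop (nhds 0)

/-- A flat is isolated if no sequence of flats, all distinct from it, converges to it. -/
def IsIsolatedFlat {d : ℕ} (Ω F : Set (Euc d)) : Prop :=
  ¬ ∃ Fs : ℕ → Set (Euc d), (∀ i, IsFlat Ω (Fs i)) ∧ (∀ i, Fs i ≠ F) ∧ FlatsConverge Fs F

/-- The union of all flats of `Ω`. -/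
def flatsUnion {d : ℕ} (Ω : Set (Euc d)) : Set (Euc d) := ⋃₀ {F | IsFlat Ω F}

/-- A boundary flat: a flat contained in the closure of a connected component of the
complement of the union of all flats. -/
def IsBoundaryFlat {d : ℕ} (Ω F : Set (Euc d)) : Prop :=
  IsFlat Ω F ∧ ∃ x ∈ Ω \ flatsUnion Ω,
    F ⊆ closure (connectedComponentIn (Ω \ flatsUnion Ω) x)

/-- A face of `Ω`: a nonempty intersection of `∂Ω` with an affine hyperplane missing `Ω`. -/
def IsFace {d : ℕ} (Ω K : Set (Euc d)) : Prop :=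
  K.Nonempty ∧ ∃ (f : Euc d →L[ℝ] ℝ) (c : ℝ), f ≠ 0 ∧ (∀ y ∈ Ω, f y ≠ c) ∧
    K = {x | f x = c} ∩ (closure Ω \ Ω)

section Degeneration

variable {V : Type*} [NormedAddCommGroup V] [NormedSpace ℝ V]
variable {ι : Type*} [Fintype ι]

/-- The linear map `∑ i, ℓ i ⊗ e i`; when `ℓ` is dual to `e` it is a projection onto the span
of `e`. -/
def coordProj (e : ι → V) (ℓ : ι → V →L[ℝ] ℝ) : V →L[ℝ] V :=
  ∑ i, (ℓ i).smulRight (e i)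

lemma coordProj_apply (e : ι → V) (ℓ : ι → V →L[ℝ] ℝ) (x : V) :
    coordProj e ℓ x = ∑ i, ℓ i x • e i := by
  simp [coordProj]

/-- Multiplication by `t` on the span of `e` and identity on the common kernel of `ℓ`. -/
def stretch (e : ι → V) (ℓ : ι → V →L[ℝ] ℝ) (t : ℝ) : V →L[ℝ] V :=
  ContinuousLinearMap.id ℝ V + (t - 1) • coordProj e ℓ

lemma stretch_apply (e : ι → V) (ℓ : ι → V →L[ℝ] ℝ) (t : ℝ) (x : V) :
    stretch e ℓ t x = x + (t - 1) • coordProj e ℓ x := by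
  simp [stretch]

/-- The closed cone that is the direct sum of the slice of `closure C` by the common kernel of `ℓ`
and of the orthant spanned by `e`. -/
def splitCone (C : Set V) (e : ι → V) (ℓ : ι → V →L[ℝ] ℝ) : Set V :=
  {x | x - coordProj e ℓ x ∈ closure C ∧ ∀ i, 0 ≤ ℓ i x}

lemma tendsto_apply_of_tendsto {T : ℕ → V →L[ℝ] V} {T₀ : V →L[ℝ] V} {x : ℕ → V} {x₀ : V}
    (hT : Tendsto T atTop (nhds T₀)) (hx : Tendsto x atTop (nhds x₀)) :
    Tendsto (fun n => T n (x n)) atTop (nhds (T₀ x₀)) :=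
  (isBoundedBilinearMap_apply.continuous.tendsto (T₀, x₀)).comp (hT.prodMk_nhds hx)

lemma opNorm_le_of_ball_bound {T : V →L[ℝ] V} {r R : ℝ} (hr : 0 < r) (hR : 0 ≤ R)
    (h : ∀ b, ‖b‖ < r → ‖T b‖ ≤ R) : ‖T‖ ≤ 2 * R / r := by
  refine T.opNorm_le_bound (by positivity) fun x => ?_
  rcases eq_or_ne x 0 with rfl | hx
  · simp
  have hx' : 0 < ‖x‖ := norm_pos_iff.2 hx
  have h1 := h ((r / 2 / ‖x‖) • x) (by
    rw [norm_smul, Real.norm_of_nonneg (by positivity)]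
    field_simp
    linarith)
  rw [map_smul, norm_smul, Real.norm_of_nonneg (by positivity)] at h1
  field_simp at h1 ⊢
  linarith

lemma norm_le_of_add_mem_of_sub_mem {A : Set V} {m : V →L[ℝ] ℝ} (hm : ∀ z ∈ A, ‖z‖ ≤ m z)
    {u q : V} (h₁ : u + q ∈ A) (h₂ : u - q ∈ A) : ‖q‖ ≤ m u := by
  have h3 : ‖(2 : ℝ) • q‖ ≤ ‖u + q‖ + ‖u - q‖ := by
    have : (2 : ℝ) • q = (u + q) - (u - q) := by module
    rw [this]
    exact norm_sub_le _ _
  have h4 := hm _ h₁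
  have h5 := hm _ h₂
  rw [map_add] at h4
  rw [map_sub] at h5
  rw [norm_smul] at h3
  norm_num at h3
  linarith

lemma closure_cone_smul_mem {C : Set V} (hC : ∀ t : ℝ, 0 < t → ∀ c ∈ C, t • c ∈ C)
    {t : ℝ} (ht : 0 < t) {c : V} (hc : c ∈ closure C) : t • c ∈ closure C :=
  map_mem_closure (continuous_const_smul t) hc (fun x hx => hC t ht x hx)

lemma closure_cone_add_mem {C : Set V} (hC : ∀ t : ℝ, 0 < t → ∀ c ∈ C, t • c ∈ C)
    (hconv : Convex ℝ C) {a b : V} (ha : a ∈ closure C) (hb : b ∈ closure C) :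
    a + b ∈ closure C := by
  have h := hconv.closure ha hb (a := 1 / 2) (b := 1 / 2) (by norm_num) (by norm_num) (by norm_num)
  have h2 := closure_cone_smul_mem hC (t := 2) (by norm_num) h
  convert h2 using 1
  module

lemma zero_mem_closure_cone {C : Set V} (hC : ∀ t : ℝ, 0 < t → ∀ c ∈ C, t • c ∈ C)
    (hne : C.Nonempty) : (0 : V) ∈ closure C := by
  obtain ⟨c, hc⟩ := hne
  have h : Tendsto (fun t : ℝ => t • c) (nhdsWithin 0 (Ioi 0)) (nhds ((0 : ℝ) • c)) :=
    ((continuous_id.smul continuous_const).tendsto (0 : ℝ)).mono_left nhdsWithin_le_nhds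
  rw [zero_smul] at h
  refine mem_closure_of_tendsto h ?_
  filter_upwards [self_mem_nhdsWithin] with t ht using hC t ht c hc

lemma closure_cone_sum_mem {C : Set V} (hC : ∀ t : ℝ, 0 < t → ∀ c ∈ C, t • c ∈ C)
    (hconv : Convex ℝ C) (hne : C.Nonempty) {e : ι → V} (he : ∀ i, e i ∈ closure C)
    {a : ι → ℝ} (ha : ∀ i, 0 ≤ a i) : ∑ i, a i • e i ∈ closure C := by
  refine Finset.sum_induction _ (· ∈ closure C) (fun _ _ => closure_cone_add_mem hC hconv)
    (zero_mem_closure_cone hC hne) fun i _ => ?_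
  rcases (ha i).eq_or_lt with h | h
  · rw [← h, zero_smul]
    exact zero_mem_closure_cone hC hne
  · exact closure_cone_smul_mem hC h (he i)

lemma nonneg_on_closure {C : Set V} {f : V →L[ℝ] ℝ} (hf : ∀ c ∈ C, 0 ≤ f c) :
    ∀ c ∈ closure C, 0 ≤ f c :=
  closure_minimal (t := {c | 0 ≤ f c}) hf (isClosed_le continuous_const f.continuous)

lemma stretch_mem_closure_of_mem_splitCone {C : Set V}
    (hcone : ∀ t : ℝ, 0 < t → ∀ c ∈ C, t • c ∈ C) (hconv : Convex ℝ C) (hne : C.Nonempty)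
    {e : ι → V} {ℓ : ι → V →L[ℝ] ℝ} (he : ∀ i, e i ∈ closure C) {x : V} (hx : x ∈ splitCone C e ℓ) {t : ℝ} (ht : 0 ≤ t) :
    stretch e ℓ t x ∈ closure C := by
  have h : stretch e ℓ t x = (x - coordProj e ℓ x) + ∑ i, (t * ℓ i x) • e i := by
    simp_rw [mul_smul, ← Finset.smul_sum, ← coordProj_apply]
    rw [stretch_apply]
    module
  rw [h]
  exact closure_cone_add_mem hcone hconv hx.1
    (closure_cone_sum_mem hcone hconv hne he fun i => mul_nonneg ht (hx.2 i))

section Dual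

variable [DecidableEq ι] {e : ι → V} {ℓ : ι → V →L[ℝ] ℝ}

lemma dual_coordProj (hdual : ∀ i j, ℓ i (e j) = if i = j then 1 else 0) (i : ι) (x : V) :
    ℓ i (coordProj e ℓ x) = ℓ i x := by
  rw [coordProj_apply, map_sum]
  simp [hdual]

lemma coordProj_coordProj (hdual : ∀ i j, ℓ i (e j) = if i = j then 1 else 0) (x : V) :
    coordProj e ℓ (coordProj e ℓ x) = coordProj e ℓ x := by
  rw [coordProj_apply e ℓ (coordProj e ℓ x)]
  simp_rw [dual_coordProj hdual]
  rw [coordProj_apply]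

lemma coordProj_self (hdual : ∀ i j, ℓ i (e j) = if i = j then 1 else 0) (j : ι) :
    coordProj e ℓ (e j) = e j := by
  simp [coordProj_apply, hdual]

lemma dual_stretch (hdual : ∀ i j, ℓ i (e j) = if i = j then 1 else 0) (t : ℝ) (i : ι) (x : V) :
    ℓ i (stretch e ℓ t x) = t * ℓ i x := by
  rw [stretch_apply, map_add, map_smul, dual_coordProj hdual, smul_eq_mul]
  ring

lemma stretch_stretch (hdual : ∀ i j, ℓ i (e j) = if i = j then 1 else 0) {s t : ℝ}
    (hst : s * t = 1) (x : V) : stretch e ℓ s (stretch e ℓ t x) = x := by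
  simp only [stretch_apply, map_add, map_smul, coordProj_coordProj hdual]
  have : (s - 1) + ((t - 1) + (t - 1) * (s - 1)) = 0 := by linear_combination hst
  rw [smul_add, smul_smul, add_assoc, ← add_smul, ← add_smul, this, zero_smul, add_zero]

variable [FiniteDimensional ℝ V]

theorem exists_equiv_image_interior_splitCone {C : Set V} (hop : IsOpen C) (hconv : Convex ℝ C)
    (hcone : ∀ t : ℝ, 0 < t → ∀ c ∈ C, t • c ∈ C) (hne : C.Nonempty)
    {m : V →L[ℝ] ℝ} (hm : ∀ z ∈ C, ‖z‖ ≤ m z)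
    (hdual : ∀ i j, ℓ i (e j) = if i = j then 1 else 0)
    (he : ∀ i, e i ∈ closure C) (hℓ : ∀ i, ∀ c ∈ C, 0 ≤ ℓ i c)
    {p : V} (hp : p ∈ interior (splitCone C e ℓ))
    {D : Set V} (hD : IsCompact D) (hDC : D ⊆ C)
    (hco : ∀ z ∈ C, ∃ g : V ≃ₗ[ℝ] V, g '' C = C ∧ g z ∈ D) :
    ∃ h : V ≃L[ℝ] V, h '' interior (splitCone C e ℓ) = C := by
  have hintC : interior (closure C) = C := by
    rw [hconv.interior_closure_eq_interior_of_nonempty_interior, hop.interior_eq]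
    rwa [hop.interior_eq]
  have hmA : ∀ z ∈ closure C, ‖z‖ ≤ m z :=
    closure_minimal (t := {z | ‖z‖ ≤ m z}) hm (isClosed_le continuous_norm m.continuous)
  have hstr : ∀ n : ℕ, ∀ x ∈ splitCone C e ℓ, stretch e ℓ ((n : ℝ) + 1)⁻¹ x ∈ closure C :=
    fun n x hx => stretch_mem_closure_of_mem_splitCone hcone hconv hne he hx (by positivity)
  have hinv : ∀ (n : ℕ) (x : V),
      stretch e ℓ ((n : ℝ) + 1) (stretch e ℓ ((n : ℝ) + 1)⁻¹ x) = x := fun n x =>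
    stretch_stretch hdual (mul_inv_cancel₀ (by positivity)) x
  have hinv' : ∀ (n : ℕ) (x : V),
      stretch e ℓ ((n : ℝ) + 1)⁻¹ (stretch e ℓ ((n : ℝ) + 1) x) = x := fun n x =>
    stretch_stretch hdual (inv_mul_cancel₀ (by positivity)) x
  obtain ⟨r, hr, hball⟩ := Metric.mem_nhds_iff.1 (mem_interior_iff_mem_nhds.1 hp)
  have hpC : ∀ n : ℕ, stretch e ℓ ((n : ℝ) + 1)⁻¹ p ∈ C := by
    intro n
    rw [← hintC, mem_interior]
    refine ⟨stretch e ℓ ((n : ℝ) + 1) ⁻¹' interior (splitCone C e ℓ), fun x hx => ?_,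
      isOpen_interior.preimage (ContinuousLinearMap.continuous _), ?_⟩
    · have := hstr n _ (interior_subset hx)
      rwa [hinv'] at this
    · rw [mem_preimage, hinv]
      exact hp
  choose g hgC hgD using fun n => hco _ (hpC n)
  have hgmem : ∀ n, ∀ x ∈ C, g n x ∈ C := fun n x hx => by
    have := mem_image_of_mem (g n) hx
    rwa [hgC] at this
  have hgsymm : ∀ n, ∀ x ∈ C, (g n).symm x ∈ C := fun n x hx => by
    rw [← hgC n] at hx
    obtain ⟨y, hy, rfl⟩ := hx
    simpa using hy
  let G : ℕ → V →L[ℝ] V := fun n => LinearMap.toContinuousLinearMap (g n : V →ₗ[ℝ] V)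
  let G' : ℕ → V →L[ℝ] V := fun n => LinearMap.toContinuousLinearMap ((g n).symm : V →ₗ[ℝ] V)
  have hGA : ∀ n, ∀ x ∈ closure C, G n x ∈ closure C := fun n x hx =>
    map_mem_closure (G n).continuous hx (hgmem n)
  let h : ℕ → V →L[ℝ] V := fun n => (G n).comp (stretch e ℓ ((n : ℝ) + 1)⁻¹)
  let k : ℕ → V →L[ℝ] V := fun n => (stretch e ℓ ((n : ℝ) + 1)).comp (G' n)
  have hhk : ∀ n x, h n (k n x) = x := fun n x => by
    change g n (stretch e ℓ _ (stretch e ℓ _ ((g n).symm x))) = x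
    rw [hinv', LinearEquiv.apply_symm_apply]
  have hkh : ∀ n x, k n (h n x) = x := fun n x => by
    change stretch e ℓ _ ((g n).symm (g n (stretch e ℓ _ x))) = x
    rw [LinearEquiv.symm_apply_apply, hinv]
  have hhD : ∀ n, h n p ∈ D := hgD
  have hhA : ∀ n, ∀ x ∈ splitCone C e ℓ, h n x ∈ closure C := fun n x hx => hGA n _ (hstr n x hx)
  obtain ⟨R, hR⟩ := hD.exists_bound_of_continuousOn m.continuous.continuousOn
  have hR0 : 0 ≤ R := (norm_nonneg _).trans (hR _ (hhD 0))
  have hhnorm : ∀ n, ‖h n‖ ≤ 2 * R / r := fun n => by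
    refine opNorm_le_of_ball_bound hr hR0 fun b hb => ?_
    refine (norm_le_of_add_mem_of_sub_mem hmA (u := h n p) ?_ ?_).trans
      ((le_abs_self _).trans (hR _ (hhD n)))
    · rw [← map_add]
      exact hhA n _ (hball (by simpa using hb))
    · rw [← map_sub]
      exact hhA n _ (hball (by simpa using hb))
  obtain ⟨δ, hδ, hthick⟩ := hD.exists_thickening_subset_open hop hDC
  have hpS : p ∈ splitCone C e ℓ := interior_subset hp
  have hmp : ∀ n : ℕ, m (stretch e ℓ ((n : ℝ) + 1)⁻¹ p) ≤ m p := fun n => by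
    have h1 : 0 ≤ m (coordProj e ℓ p) := by
      refine (norm_nonneg _).trans (hmA _ ?_)
      rw [coordProj_apply]
      exact closure_cone_sum_mem hcone hconv hne he hpS.2
    have h2 : ((n : ℝ) + 1)⁻¹ - 1 ≤ 0 := by
      have : ((n : ℝ) + 1)⁻¹ ≤ 1 := inv_le_one_of_one_le₀ (by linarith [n.cast_nonneg (α := ℝ)])
      linarith
    rw [stretch_apply, map_add, map_smul, smul_eq_mul]
    nlinarith
  have hmp0 : 0 ≤ m p := (norm_nonneg _).trans ((hmA _ (subset_closure (hpC 0))).trans (hmp 0))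
  have hknorm : ∀ n, ‖k n‖ ≤ 2 * (m p + ∑ i, ℓ i p * ‖e i‖) / δ := fun n => by
    refine opNorm_le_of_ball_bound hδ (add_nonneg hmp0 (Finset.sum_nonneg fun i _ =>
      mul_nonneg (hpS.2 i) (norm_nonneg _))) fun b hb => ?_
    have hsymm : (g n).symm (h n p) = stretch e ℓ ((n : ℝ) + 1)⁻¹ p :=
      (g n).symm_apply_apply _
    have hmem : ∀ b' : V, ‖b'‖ < δ → h n p + b' ∈ C := fun b' hb' =>
      hthick (mem_thickening_iff.2 ⟨h n p, hhD n, by simpa using hb'⟩)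
    have h1 := hgsymm n _ (hmem b hb)
    have h2 := hgsymm n _ (hmem (-b) (by simpa using hb))
    rw [map_add, hsymm] at h1
    rw [← sub_eq_add_neg, map_sub, hsymm] at h2
    have hq := (norm_le_of_add_mem_of_sub_mem hm h1 h2).trans (hmp n)
    have hn1 : (0 : ℝ) < (n : ℝ) + 1 := by positivity
    have hcoord : ∀ i, |ℓ i ((g n).symm b)| ≤ ((n : ℝ) + 1)⁻¹ * ℓ i p := fun i => by
      have h3 := hℓ i _ h1
      have h4 := hℓ i _ h2
      rw [map_add, dual_stretch hdual] at h3
      rw [map_sub, dual_stretch hdual] at h4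
      exact abs_le.2 ⟨by linarith, by linarith⟩
    change ‖stretch e ℓ ((n : ℝ) + 1) ((g n).symm b)‖ ≤ _
    rw [stretch_apply, coordProj_apply, add_sub_cancel_right, Finset.smul_sum]
    refine (norm_add_le _ _).trans (add_le_add hq ((norm_sum_le _ _).trans
      (Finset.sum_le_sum fun i _ => ?_)))
    rw [norm_smul, norm_smul, Real.norm_eq_abs, Real.norm_eq_abs, ← mul_assoc]
    refine mul_le_mul_of_nonneg_right ?_ (norm_nonneg _)
    calc |(n : ℝ)| * |ℓ i ((g n).symm b)| ≤ ((n : ℝ) + 1) * (((n : ℝ) + 1)⁻¹ * ℓ i p) := by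
          rw [abs_of_nonneg n.cast_nonneg]
          exact mul_le_mul (by linarith) (hcoord i) (abs_nonneg _) hn1.le
      _ = ℓ i p := by field_simp
  obtain ⟨⟨h₀, k₀⟩, -, φ, hφ, hlim⟩ :=
    (isCompact_closedBall (0 : (V →L[ℝ] V) × (V →L[ℝ] V))
      (max (2 * R / r) (2 * (m p + ∑ i, ℓ i p * ‖e i‖) / δ))).tendsto_subseq
      (x := fun n => (h n, k n)) (fun n => by
        rw [mem_closedBall_zero_iff, Prod.norm_def]
        exact max_le_max (hhnorm n) (hknorm n))
  have hh₀ : Tendsto (fun n => h (φ n)) atTop (nhds h₀) := (continuous_fst.tendsto _).comp hlim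
  have hk₀ : Tendsto (fun n => k (φ n)) atTop (nhds k₀) := (continuous_snd.tendsto _).comp hlim
  have hleft : ∀ x, h₀ (k₀ x) = x := fun x =>
    tendsto_nhds_unique (tendsto_apply_of_tendsto hh₀ (tendsto_apply_of_tendsto hk₀ tendsto_const_nhds))
      (tendsto_const_nhds.congr fun n => (hhk (φ n) x).symm)
  have hright : ∀ x, k₀ (h₀ x) = x := fun x =>
    tendsto_nhds_unique (tendsto_apply_of_tendsto hk₀ (tendsto_apply_of_tendsto hh₀ tendsto_const_nhds))
      (tendsto_const_nhds.congr fun n => (hkh (φ n) x).symm)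
  let H : V ≃L[ℝ] V := ContinuousLinearEquiv.equivOfInverse h₀ k₀ hright hleft
  have hHsub : H '' splitCone C e ℓ ⊆ closure C := by
    rintro _ ⟨x, hx, rfl⟩
    exact isClosed_closure.mem_of_tendsto (tendsto_apply_of_tendsto hh₀ (tendsto_const_nhds (x := x)))
      (Eventually.of_forall fun n => hhA (φ n) x hx)
  have hCsub : C ⊆ H '' splitCone C e ℓ := by
    intro z hz
    refine ⟨k₀ z, ?_, hleft z⟩
    have hkz : Tendsto (fun n => k (φ n) z) atTop (nhds (k₀ z)) :=
      tendsto_apply_of_tendsto hk₀ tendsto_const_nhds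
    have hq : ∀ n, (G' n) z ∈ C := fun n => hgsymm n z hz
    have hkq : ∀ n : ℕ, stretch e ℓ ((n : ℝ) + 1)⁻¹ (k n z) = G' n z := fun n => hinv' n _
    constructor
    · have hcoef : Tendsto (fun n => ((φ n : ℝ) + 1)⁻¹ - 1) atTop (nhds (0 - 1)) := by
        have h1 : Tendsto (fun n : ℕ => ((n : ℝ) + 1)⁻¹) atTop (nhds 0) := by
          simpa using tendsto_one_div_add_atTop_nhds_zero_nat (𝕜 := ℝ)
        exact (h1.comp hφ.tendsto_atTop).sub_const 1
      have hl := hkz.add (hcoef.smul (((coordProj e ℓ).continuous.tendsto _).comp hkz))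
      have heq : k₀ z + ((0 : ℝ) - 1) • coordProj e ℓ (k₀ z) = k₀ z - coordProj e ℓ (k₀ z) := by
        module
      rw [heq] at hl
      refine mem_closure_of_tendsto hl (Eventually.of_forall fun n => ?_)
      have := hq (φ n)
      rw [← hkq, stretch_apply] at this
      exact this
    · intro i
      refine ge_of_tendsto (((ℓ i).continuous.tendsto _).comp hkz)
        (Eventually.of_forall fun n => ?_)
      change 0 ≤ ℓ i (stretch e ℓ ((φ n : ℝ) + 1) (G' (φ n) z))
      rw [dual_stretch hdual]
      exact mul_nonneg (by positivity) (hℓ i _ (hq _))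
  refine ⟨H, Subset.antisymm ?_ ?_⟩
  · calc H '' interior (splitCone C e ℓ) = interior (H '' splitCone C e ℓ) :=
        H.toHomeomorph.image_interior _
      _ ⊆ interior (closure C) := interior_mono hHsub
      _ = C := hintC
  · calc C ⊆ interior (H '' splitCone C e ℓ) := interior_maximal hCsub hop
      _ = H '' interior (splitCone C e ℓ) := (H.toHomeomorph.image_interior _).symm

end Dual
end Degeneration

section Split

variable {V : Type*} [NormedAddCommGroup V] [NormedSpace ℝ V]
variable {ι : Type*} [Fintype ι] {e : ι → V} {ℓ : ι → V →L[ℝ] ℝ}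

lemma convex_splitCone {C : Set V} (hconv : Convex ℝ C) : Convex ℝ (splitCone C e ℓ) := by
  rw [splitCone, ofPred_and]
  refine Convex.inter ?_ ?_
  · exact hconv.closure.linear_preimage
      ((ContinuousLinearMap.id ℝ V - coordProj e ℓ : V →L[ℝ] V) : V →ₗ[ℝ] V)
  · rw [ofPred_forall]
    exact convex_iInter fun i => convex_halfSpace_ge (ℓ i).toLinearMap.isLinear 0

lemma smul_mem_splitCone {C : Set V} (hcone : ∀ t : ℝ, 0 < t → ∀ c ∈ C, t • c ∈ C)
    {t : ℝ} (ht : 0 < t) {x : V} (hx : x ∈ splitCone C e ℓ) : t • x ∈ splitCone C e ℓ := by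
  refine ⟨?_, fun i => ?_⟩
  · rw [map_smul, ← smul_sub]
    exact closure_cone_smul_mem hcone ht hx.1
  · rw [map_smul, smul_eq_mul]
    exact mul_nonneg ht.le (hx.2 i)

lemma smul_mem_interior_splitCone {C : Set V} (hcone : ∀ t : ℝ, 0 < t → ∀ c ∈ C, t • c ∈ C)
    {t : ℝ} (ht : 0 < t) {x : V} (hx : x ∈ interior (splitCone C e ℓ)) :
    t • x ∈ interior (splitCone C e ℓ) := by
  have h := image_mono (f := fun y : V => t • y) (interior_subset (s := splitCone C e ℓ))
  refine interior_maximal (h.trans ?_) ?_ (mem_image_of_mem _ hx)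
  · rintro _ ⟨y, hy, rfl⟩
    exact smul_mem_splitCone hcone ht hy
  · exact isOpenMap_smul₀ ht.ne' _ isOpen_interior

lemma sub_add_mem_interior_splitCone [DecidableEq ι] {C : Set V}
    (hdual : ∀ i j, ℓ i (e j) = if i = j then 1 else 0) {x y : V}
    (hx : x ∈ interior (splitCone C e ℓ)) (hy : y ∈ interior (splitCone C e ℓ)) :
    (x - coordProj e ℓ x) + coordProj e ℓ y ∈ interior (splitCone C e ℓ) := by
  set P := coordProj e ℓ with hP
  have hPP : ∀ z, P (P z) = P z := coordProj_coordProj hdual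
  have hℓP : ∀ i z, ℓ i (P z) = ℓ i z := dual_coordProj hdual
  let f : V → V := fun z => P x + (z - P z)
  let g : V → V := fun z => (y - P y) + P z
  have hf : Continuous f := by fun_prop
  have hg : Continuous g := by fun_prop
  refine interior_maximal (s := splitCone C e ℓ)
    (t := f ⁻¹' interior (splitCone C e ℓ) ∩ g ⁻¹' interior (splitCone C e ℓ)) ?_
    ((isOpen_interior.preimage hf).inter (isOpen_interior.preimage hg)) ⟨?_, ?_⟩
  · rintro z ⟨hzf, hzg⟩
    constructor
    · have h1 := (interior_subset hzf).1
      simp only [f, ← hP, map_add, map_sub, hPP] at h1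
      convert h1 using 1
      abel
    · intro i
      have h2 := (interior_subset hzg).2 i
      simp only [g, map_add, map_sub, hℓP] at h2
      linarith
  · have : f (x - P x + P y) = x := by
      simp only [f, map_add, map_sub, hPP]
      abel
    rw [mem_preimage, this]
    exact hx
  · have : g (x - P x + P y) = y := by
      simp only [g, map_add, map_sub, hPP]
      abel
    rw [mem_preimage, this]
    exact hy

end Split

section Cone

variable {d : ℕ}

lemma not_isIrreducibleDomain_of_splitCone {ι : Type*} [Fintype ι] [DecidableEq ι] [Nonempty ι]
    {e : ι → Euc d × ℝ} {ℓ : ι → Euc d × ℝ →L[ℝ] ℝ} {Ω : Set (Euc d)} {C : Set (Euc d × ℝ)}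
    (hconv : Convex ℝ C) (hcone : ∀ t : ℝ, 0 < t → ∀ c ∈ C, t • c ∈ C)
    (hdual : ∀ i j, ℓ i (e j) = if i = j then 1 else 0) {y : Euc d × ℝ} (hy : y ≠ 0)
    (hℓy : ∀ i, ℓ i y = 0) (h : (Euc d × ℝ) ≃L[ℝ] (Euc d × ℝ))
    (hh : h '' interior (splitCone C e ℓ) = coneOver Ω) : ¬ IsIrreducibleDomain Ω := by
  set P : Euc d × ℝ →L[ℝ] Euc d × ℝ := coordProj e ℓ with hP
  have hPP : ∀ z, P (P z) = P z := coordProj_coordProj hdual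
  have hidem : IsIdempotentElem (P : Euc d × ℝ →ₗ[ℝ] Euc d × ℝ) := LinearMap.ext hPP
  have hcompl := (LinearMap.IsIdempotentElem.isCompl hidem).symm
  let L : (Euc d × ℝ) ≃ₗ[ℝ] (Euc d × ℝ) := h.toLinearEquiv
  let V₁ := (P : Euc d × ℝ →ₗ[ℝ] Euc d × ℝ).ker.map (L : Euc d × ℝ →ₗ[ℝ] Euc d × ℝ)
  let V₂ := (P : Euc d × ℝ →ₗ[ℝ] Euc d × ℝ).range.map (L : Euc d × ℝ →ₗ[ℝ] Euc d × ℝ)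
  have hV : IsCompl V₁ V₂ := (Submodule.orderIsoMapComap L).isCompl hcompl
  have hV₁ : V₁ ≠ ⊥ := by
    intro hbot
    have hmem : h y ∈ V₁ := Submodule.mem_map_of_mem (f := (L : Euc d × ℝ →ₗ[ℝ] Euc d × ℝ)) (by
      rw [LinearMap.mem_ker]
      change coordProj e ℓ y = 0
      simp [coordProj_apply, hℓy])
    rw [hbot, Submodule.mem_bot] at hmem
    exact hy (by simpa using hmem)
  have hV₂ : V₂ ≠ ⊥ := by
    intro hbot
    obtain ⟨i⟩ := ‹Nonempty ι›
    have hmem : h (P (e i)) ∈ V₂ :=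
      Submodule.mem_map_of_mem (f := (L : Euc d × ℝ →ₗ[ℝ] Euc d × ℝ)) ⟨e i, rfl⟩
    rw [hbot, Submodule.mem_bot] at hmem
    have h0 : P (e i) = 0 := by simpa using hmem
    have h1 : ℓ i (P (e i)) = ℓ i (e i) := dual_coordProj hdual i _
    rw [h0, map_zero, hdual] at h1
    simp at h1
  let T := interior (splitCone C e ℓ)
  have hT : Convex ℝ T := (convex_splitCone hconv).interior
  let A₁ : Euc d × ℝ →ₗ[ℝ] Euc d × ℝ :=
    ((h : Euc d × ℝ →L[ℝ] Euc d × ℝ).comp (ContinuousLinearMap.id ℝ (Euc d × ℝ) - P) :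
      Euc d × ℝ →L[ℝ] Euc d × ℝ)
  let A₂ : Euc d × ℝ →ₗ[ℝ] Euc d × ℝ :=
    ((h : Euc d × ℝ →L[ℝ] Euc d × ℝ).comp P : Euc d × ℝ →L[ℝ] Euc d × ℝ)
  have hA₁ : ∀ x, A₁ x = h (x - P x) := fun x => rfl
  have hA₂ : ∀ x, A₂ x = h (P x) := fun x => rfl
  have hcones : ∀ A : Euc d × ℝ →ₗ[ℝ] Euc d × ℝ, ∀ t : ℝ, 0 < t → ∀ c ∈ A '' T,
      t • c ∈ A '' T := by
    rintro A t ht _ ⟨x, hx, rfl⟩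
    exact ⟨t • x, smul_mem_interior_splitCone hcone ht hx, map_smul _ _ _⟩
  refine fun hirr => hirr ⟨V₁, V₂, A₁ '' T, A₂ '' T, hV₁, hV₂, ?_, ?_, hV, ?_, ?_,
    hT.linear_image _, hT.linear_image _, hcones _, hcones _, ?_⟩
  · intro htop
    rw [htop] at hV
    exact hV₂ (eq_bot_of_top_isCompl hV)
  · intro htop
    rw [htop] at hV
    exact hV₁ (eq_bot_of_isCompl_top hV)
  · rintro _ ⟨x, -, rfl⟩
    refine Submodule.mem_map_of_mem (f := (L : Euc d × ℝ →ₗ[ℝ] Euc d × ℝ)) ?_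
    rw [LinearMap.mem_ker]
    change P (x - P x) = 0
    rw [map_sub, hPP, sub_self]
  · rintro _ ⟨x, -, rfl⟩
    exact Submodule.mem_map_of_mem (f := (L : Euc d × ℝ →ₗ[ℝ] Euc d × ℝ)) ⟨x, rfl⟩
  · rw [← hh]
    ext z
    constructor
    · rintro ⟨x, hx, rfl⟩
      refine ⟨A₁ x, ⟨x, hx, rfl⟩, A₂ x, ⟨x, hx, rfl⟩, ?_⟩
      rw [hA₁, hA₂, ← map_add, sub_add_cancel]
    · rintro ⟨_, ⟨x, hx, rfl⟩, _, ⟨y, hy, rfl⟩, rfl⟩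
      refine ⟨x - P x + P y, sub_add_mem_interior_splitCone hdual hx hy, ?_⟩
      rw [hA₁, hA₂, map_add]

lemma mem_coneOver_iff {Ω : Set (Euc d)} {z : Euc d × ℝ} :
    z ∈ coneOver Ω ↔ 0 < z.2 ∧ z.2⁻¹ • z.1 ∈ Ω := by
  constructor
  · rintro ⟨t, ht, x, hx, rfl⟩
    simpa [ht.ne', smul_smul, ht] using hx
  · rintro ⟨h1, h2⟩
    refine ⟨z.2, h1, _, h2, ?_⟩
    ext1 <;> simp [smul_smul, h1.ne']

lemma mk_one_mem_coneOver {Ω : Set (Euc d)} {x : Euc d} :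
    ((x, 1) : Euc d × ℝ) ∈ coneOver Ω ↔ x ∈ Ω := by
  simp [mem_coneOver_iff]

lemma mk_one_mem_closure_coneOver {Ω : Set (Euc d)} {x : Euc d} (hx : x ∈ closure Ω) :
    ((x, 1) : Euc d × ℝ) ∈ closure (coneOver Ω) :=
  map_mem_closure (f := fun x : Euc d => ((x, 1) : Euc d × ℝ)) (by fun_prop) hx
    fun _ h => mk_one_mem_coneOver.2 h

lemma smul_mem_coneOver {Ω : Set (Euc d)} (t : ℝ) (ht : 0 < t) (c : Euc d × ℝ)
    (hc : c ∈ coneOver Ω) : t • c ∈ coneOver Ω := by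
  obtain ⟨s, hs, x, hx, rfl⟩ := hc
  exact ⟨t * s, mul_pos ht hs, x, hx, smul_smul _ _ _⟩

lemma isOpen_coneOver {Ω : Set (Euc d)} (hop : IsOpen Ω) : IsOpen (coneOver Ω) := by
  have h : coneOver Ω = {z | 0 < z.2} ∩ (fun z : Euc d × ℝ => z.2⁻¹ • z.1) ⁻¹' Ω := by
    ext z
    exact mem_coneOver_iff
  rw [h]
  refine ContinuousOn.isOpen_inter_preimage ?_ (isOpen_lt continuous_const continuous_snd) hop
  exact (continuousOn_snd.inv₀ fun z hz => (ne_of_gt hz)).smul continuousOn_fst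

lemma convex_coneOver {Ω : Set (Euc d)} (hconv : Convex ℝ Ω) : Convex ℝ (coneOver Ω) := by
  refine convex_iff_forall_pos.2 ?_
  rintro _ ⟨s, hs, x, hx, rfl⟩ _ ⟨t, ht, y, hy, rfl⟩ a b ha hb -
  have hpos : 0 < a * s + b * t := by positivity
  refine ⟨a * s + b * t, hpos, (a * s / (a * s + b * t)) • x + (b * t / (a * s + b * t)) • y,
    hconv hx hy (by positivity) (by positivity) (by field_simp), ?_⟩
  ext1
  · simp only [Prod.smul_fst, Prod.fst_add, smul_add, smul_smul]
    congr 2 <;> field_simp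
  · simp

lemma exists_norm_le_on_coneOver {Ω : Set (Euc d)} (hbd : Bornology.IsBounded Ω) :
    ∃ m : Euc d × ℝ →L[ℝ] ℝ, ∀ z ∈ coneOver Ω, ‖z‖ ≤ m z := by
  obtain ⟨B, hB⟩ := hbd.exists_norm_le
  refine ⟨(max B 1) • ContinuousLinearMap.snd ℝ (Euc d) ℝ, ?_⟩
  rintro _ ⟨t, ht, x, hx, rfl⟩
  rw [norm_smul, Real.norm_of_nonneg ht.le, Prod.norm_def]
  have h1 : max ‖x‖ ‖(1 : ℝ)‖ ≤ max B 1 := max_le_max (hB x hx) (by simp)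
  simpa [mul_comm] using mul_le_mul_of_nonneg_left h1 ht.le

lemma Divides.exists_compact_cone {Ω : Set (Euc d)}
    {Γ : Subgroup ((Euc d × ℝ) ≃ₗ[ℝ] (Euc d × ℝ))} (hdiv : Divides Ω Γ) :
    ∃ D : Set (Euc d × ℝ), IsCompact D ∧ D ⊆ coneOver Ω ∧ ∀ z ∈ coneOver Ω,
      ∃ g : (Euc d × ℝ) ≃ₗ[ℝ] (Euc d × ℝ), g '' coneOver Ω = coneOver Ω ∧ g z ∈ D := by
  obtain ⟨hΓ, -, -, K, hKΩ, hK, hcov⟩ := hdiv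
  refine ⟨(fun x => (x, 1)) '' K, hK.image (by fun_prop), ?_, ?_⟩
  · rintro _ ⟨x, hx, rfl⟩
    exact mk_one_mem_coneOver.2 (hKΩ hx)
  · rintro _ ⟨t, ht, x, hx, rfl⟩
    rw [← hcov] at hx
    simp only [mem_iUnion, mem_image] at hx
    obtain ⟨γ, hγ, k, hk, rfl⟩ := hx
    have hmem : γ (k, 1) ∈ coneOver Ω := by
      rw [← hΓ γ hγ]
      exact mem_image_of_mem _ (mk_one_mem_coneOver.2 (hKΩ hk))
    have hτ := (mem_coneOver_iff.1 hmem).1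
    set τ := (γ (k, 1)).2 with hτdef
    have hγk : ((projAct γ k, 1) : Euc d × ℝ) = τ⁻¹ • γ (k, 1) := by
      ext1
      · rfl
      · simp [← hτdef, hτ.ne']
    have hc : τ / t ≠ 0 := (div_pos hτ ht).ne'
    refine ⟨γ.symm.trans (LinearEquiv.smulOfNeZero ℝ _ (τ / t) hc), ?_, k, hk, ?_⟩
    · have hsymm : ∀ z ∈ coneOver Ω, γ.symm z ∈ coneOver Ω := fun z hz => by
        rw [← hΓ γ hγ] at hz
        obtain ⟨w, hw, rfl⟩ := hz
        simpa using hw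
      refine Subset.antisymm ?_ fun z hz => ?_
      · rintro _ ⟨z, hz, rfl⟩
        exact smul_mem_coneOver _ (div_pos hτ ht) _ (hsymm z hz)
      · refine ⟨γ ((τ / t)⁻¹ • z), ?_, ?_⟩
        · rw [← hΓ γ hγ]
          exact mem_image_of_mem _ (smul_mem_coneOver _ (inv_pos.2 (div_pos hτ ht)) _ hz)
        · change (τ / t) • γ.symm (γ ((τ / t)⁻¹ • z)) = z
          rw [LinearEquiv.symm_apply_apply, smul_inv_smul₀ hc]
    · change _ = (τ / t) • γ.symm (t • (projAct γ k, 1))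
      rw [hγk, map_smul, map_smul, LinearEquiv.symm_apply_apply, smul_smul, smul_smul]
      have : τ / t * (t * τ⁻¹) = 1 := by field_simp
      dsimp only
      rw [mul_assoc, this, one_smul]

end Cone

section Simplex

variable {d : ℕ} {ι : Type*} [Fintype ι]

lemma mem_convexHull_range_iff_exists_weights {E : Type*} [AddCommGroup E] [Module ℝ E]
    {v : ι → E} {x : E} : x ∈ convexHull ℝ (range v) ↔
      ∃ w : ι → ℝ, (∀ i, 0 ≤ w i) ∧ ∑ i, w i = 1 ∧ ∑ i, w i • v i = x := by
  classical
  constructor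
  · rw [convexHull_range_eq_exists_affineCombination]
    rintro ⟨s, w, hw, hw1, hx⟩
    refine ⟨fun i => if i ∈ s then w i else 0, fun i => ?_, ?_, ?_⟩
    · dsimp only
      split_ifs with h
      · exact hw i h
      · exact le_rfl
    · simpa [Finset.sum_ite_mem] using hw1
    · rw [← hx, Finset.affineCombination_eq_linear_combination _ _ _ hw1]
      simp [ite_smul, Finset.sum_ite_mem]
  · rintro ⟨w, hw, hw1, hx⟩
    exact mem_convexHull_of_exists_fintype w v hw hw1 (fun i => mem_range_self i) hx

lemma mem_affineSpan_range_iff_exists_weights {E : Type*} [AddCommGroup E] [Module ℝ E]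
    {v : ι → E} {x : E} : x ∈ affineSpan ℝ (range v) ↔
      ∃ w : ι → ℝ, ∑ i, w i = 1 ∧ ∑ i, w i • v i = x := by
  constructor
  · intro h
    obtain ⟨w, hw, hx⟩ := eq_affineCombination_of_mem_affineSpan_of_fintype h
    exact ⟨w, hw, by rw [hx, Finset.affineCombination_eq_linear_combination _ _ _ hw]⟩
  · rintro ⟨w, hw, rfl⟩
    rw [← Finset.affineCombination_eq_linear_combination _ _ _ hw]
    exact affineCombination_mem_affineSpan hw v

lemma sum_smul_mk_one {E : Type*} [AddCommGroup E] [Module ℝ E] (v : ι → E) (w : ι → ℝ) :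
    ∑ i, w i • ((v i, 1) : E × ℝ) = (∑ i, w i • v i, ∑ i, w i) := by
  ext1 <;> simp [Prod.fst_sum, Prod.snd_sum]

lemma AffineIndependent.linearIndependent_mk_one {E : Type*} [AddCommGroup E] [Module ℝ E]
    {v : ι → E} (hv : AffineIndependent ℝ v) :
    LinearIndependent ℝ (fun i => ((v i, 1) : E × ℝ)) := by
  rw [Fintype.linearIndependent_iff]
  intro w hw i
  rw [sum_smul_mk_one, Prod.mk_eq_zero] at hw
  exact affineIndependent_iff.1 hv Finset.univ w hw.2 hw.1 i (Finset.mem_univ i)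

lemma eventually_lineMap_mem_of_mem_intrinsicInterior {E : Type*} [NormedAddCommGroup E]
    [NormedSpace ℝ E] {T : Set E} {x y : E} (hx : x ∈ intrinsicInterior ℝ T)
    (hy : y ∈ affineSpan ℝ T) : ∀ᶠ s in nhds (0 : ℝ), AffineMap.lineMap x y s ∈ T := by
  obtain ⟨x', hx', rfl⟩ := hx
  let f : ℝ → affineSpan ℝ T := fun s =>
    ⟨AffineMap.lineMap (x' : E) y s, AffineMap.lineMap_mem s x'.2 hy⟩
  have hf : Continuous f := by
    refine Continuous.subtype_mk ?_ _
    exact AffineMap.lineMap_continuous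
  have h0 : f 0 = x' := Subtype.ext (AffineMap.lineMap_apply_zero _ _)
  have h1 : ∀ᶠ s in nhds (0 : ℝ), f s ∈ interior ((↑) ⁻¹' T : Set (affineSpan ℝ T)) :=
    hf.continuousAt.eventually_mem (by
      rw [h0]
      exact isOpen_interior.mem_nhds hx')
  exact h1.mono fun s hs => by
    have h2 : f s ∈ ((↑) ⁻¹' T : Set (affineSpan ℝ T)) := interior_subset hs
    exact h2

section Flat

variable {Ω : Set (Euc d)} {v : Fin d → Euc d}

lemma IsFlatWith.mem_intrinsicInterior_of_mem (hv : IsFlatWith Ω v) {x : Euc d}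
    (hx : x ∈ convexHull ℝ (range v)) (hxΩ : x ∈ Ω) :
    x ∈ intrinsicInterior ℝ (convexHull ℝ (range v)) := by
  by_contra h
  exact (hv.2.2.2 ⟨hx, h⟩).2 hxΩ

lemma intrinsicInterior_convexHull_range_nonempty {v : Fin d → Euc d} (hd : 0 < d) :
    (intrinsicInterior ℝ (convexHull ℝ (range v))).Nonempty := by
  refine Set.Nonempty.intrinsicInterior (convex_convexHull ℝ _) ?_
  exact ⟨v ⟨0, hd⟩, subset_convexHull ℝ _ (mem_range_self _)⟩

lemma IsFlatWith.mem_convexHull_of_mem_affineSpan (hv : IsFlatWith Ω v) (hd : 0 < d)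
    (hconv : Convex ℝ Ω) {x : Euc d} (hx : x ∈ affineSpan ℝ (range v)) (hxΩ : x ∈ Ω) :
    x ∈ convexHull ℝ (range v) := by
  set T := convexHull ℝ (range v) with hT
  obtain ⟨p, hp⟩ := intrinsicInterior_convexHull_range_nonempty (v := v) hd
  have hspan : affineSpan ℝ T = affineSpan ℝ (range v) := affineSpan_convexHull _
  have hTc : IsClosed T := ((finite_range v).isCompact_convexHull ℝ).isClosed
  let γ : ℝ → Euc d := fun s => AffineMap.lineMap p x s
  have hγ : Continuous γ := AffineMap.lineMap_continuous
  have hsub : Icc (0 : ℝ) 1 ⊆ γ ⁻¹' T := by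
    refine IsClosed.Icc_subset_of_forall_mem_nhdsWithin
      ((hTc.preimage hγ).inter isClosed_Icc) ?_ ?_
    · change AffineMap.lineMap p x (0 : ℝ) ∈ T
      rw [AffineMap.lineMap_apply_zero]
      exact intrinsicInterior_subset hp
    · rintro s ⟨hsT, hs0, hs1⟩
      have hsΩ : γ s ∈ Ω := by
        have : γ s ∈ segment ℝ p x := by
          rw [segment_eq_image_lineMap]
          exact ⟨s, ⟨hs0, hs1.le⟩, rfl⟩
        exact hconv.segment_subset (hv.2.2.1 hp) hxΩ this
      have hsF := hv.mem_intrinsicInterior_of_mem hsT hsΩ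
      have hev := eventually_lineMap_mem_of_mem_intrinsicInterior hsF
        (y := γ (s + 1)) (by
          rw [hspan]
          exact AffineMap.lineMap_mem _ (by
            rw [← hspan]
            exact subset_affineSpan ℝ T (intrinsicInterior_subset hp)) hx)
      have htend : Tendsto (fun u : ℝ => u - s) (nhdsWithin s (Ioi s)) (nhds 0) := by
        have : Tendsto (fun u : ℝ => u - s) (nhds s) (nhds (s - s)) :=
          (continuous_sub_right s).tendsto s
        rw [sub_self] at this
        exact this.mono_left nhdsWithin_le_nhds
      filter_upwards [htend.eventually hev] with u hu
      change γ u ∈ T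
      convert hu using 1
      simp only [γ, AffineMap.lineMap_apply_module]
      module
  have h1 : γ 1 ∈ T := hsub ⟨zero_le_one, le_rfl⟩
  simpa [γ] using h1

lemma IsFlatWith.weight_pos (hv : IsFlatWith Ω v) (hd : 0 < d)
    (hconv : Convex ℝ Ω) {w : Fin d → ℝ} (hw : ∑ i, w i = 1) (hx : ∑ i, w i • v i ∈ Ω)
    (i : Fin d) : 0 < w i := by
  have hxs : ∑ i, w i • v i ∈ affineSpan ℝ (range v) :=
    mem_affineSpan_range_iff_exists_weights.2 ⟨w, hw, rfl⟩
  have hxF := hv.mem_intrinsicInterior_of_mem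
    (hv.mem_convexHull_of_mem_affineSpan hd hconv hxs hx) hx
  have hev := eventually_lineMap_mem_of_mem_intrinsicInterior hxF (y := v i) (by
    rw [affineSpan_convexHull]
    exact subset_affineSpan ℝ _ (mem_range_self i))
  obtain ⟨s, hs, hs0⟩ : ∃ s : ℝ, AffineMap.lineMap (∑ i, w i • v i) (v i) s ∈
      convexHull ℝ (range v) ∧ s < 0 :=
    ((hev.filter_mono nhdsWithin_le_nhds).and
      (self_mem_nhdsWithin : Iio (0 : ℝ) ∈ nhdsWithin 0 (Iio 0))).exists
  obtain ⟨u, hu0, hu1, hu⟩ := mem_convexHull_range_iff_exists_weights.1 hs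
  have hlin := Fintype.linearIndependent_iff.1 hv.1.linearIndependent_mk_one
    (fun j => (1 - s) * w j + s * (if j = i then 1 else 0) - u j) (by
      rw [sum_smul_mk_one]
      rw [AffineMap.lineMap_apply_module] at hu
      ext1
      · simp only [sub_smul _ (u _), add_smul _ (s * _), mul_smul, Finset.sum_sub_distrib,
          Finset.sum_add_distrib, ← Finset.smul_sum, hu, ite_smul, one_smul, zero_smul,
          Finset.sum_ite_eq', Finset.mem_univ, if_true, Prod.fst_zero]
        abel
      · simp only [Finset.sum_sub_distrib, Finset.sum_add_distrib, ← Finset.mul_sum, hw, hu1,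
          Finset.sum_ite_eq', Finset.mem_univ, if_true, Prod.snd_zero]
        ring) i
  simp only [if_true] at hlin
  have := hu0 i
  nlinarith

lemma IsFlatWith.coord_pos_of_mem_coneOver (hv : IsFlatWith Ω v) (hd : 0 < d)
    (hconv : Convex ℝ Ω) {w : Fin d → ℝ}
    (hw : ∑ i, w i • ((v i, 1) : Euc d × ℝ) ∈ coneOver Ω) (i : Fin d) : 0 < w i := by
  rw [sum_smul_mk_one, mem_coneOver_iff] at hw
  obtain ⟨hpos, hmem⟩ := hw
  dsimp only at hpos hmem
  have h := hv.weight_pos hd hconv (w := fun j => (∑ i, w i)⁻¹ * w j)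
    (by rw [← Finset.mul_sum, inv_mul_cancel₀ hpos.ne'])
    (by simpa only [mul_smul, ← Finset.smul_sum] using hmem) i
  exact (mul_pos_iff_of_pos_left (inv_pos.2 hpos)).1 h

lemma IsFlatWith.exists_dual (hv : IsFlatWith Ω v) (hd : 0 < d)
    (hop : IsOpen Ω) (hconv : Convex ℝ Ω) (i : Fin d) :
    ∃ ℓ : Euc d × ℝ →L[ℝ] ℝ, (∀ j, ℓ (v j, 1) = if i = j then 1 else 0) ∧
      ∀ c ∈ coneOver Ω, 0 < ℓ c := by
  let e : Fin d → Euc d × ℝ := fun j => (v j, 1)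
  let Q : Set (Euc d × ℝ) := {z | ∃ w : Fin d → ℝ, w i ≤ 0 ∧ ∑ j, w j • e j = z}
  have hQ : Convex ℝ Q := by
    rintro _ ⟨w, hw, rfl⟩ _ ⟨u, hu, rfl⟩ a b ha hb -
    refine ⟨fun j => a * w j + b * u j, ?_, ?_⟩
    · nlinarith
    · simp only [add_smul, mul_smul, Finset.sum_add_distrib, Finset.smul_sum]
  have hdisj : Disjoint (coneOver Ω) Q := by
    rw [Set.disjoint_left]
    rintro _ hz ⟨w, hw, rfl⟩
    exact (hv.coord_pos_of_mem_coneOver hd hconv hz i).not_ge hw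
  obtain ⟨f, u, hfC, hfQ⟩ := geometric_hahn_banach_open (convex_coneOver hconv)
    (isOpen_coneOver hop) hQ hdisj
  have hu0 : u ≤ 0 := by
    simpa using hfQ 0 ⟨0, le_rfl, by simp⟩
  have hCneg : ∀ c ∈ coneOver Ω, f c < 0 := fun c hc => (hfC c hc).trans_le hu0
  have hQcone : ∀ z ∈ Q, ∀ t : ℝ, 0 ≤ t → t • z ∈ Q := by
    rintro _ ⟨w, hw, rfl⟩ t ht
    exact ⟨fun j => t * w j, by nlinarith, by simp only [mul_smul, Finset.smul_sum]⟩
  have hQnonneg : ∀ z ∈ Q, 0 ≤ f z := by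
    intro z hz
    by_contra! hneg
    have h1 := hfQ _ (hQcone z hz ((u - 1) / f z)
      (div_nonneg_of_nonpos (by linarith) hneg.le))
    rw [map_smul, smul_eq_mul, div_mul_cancel₀ _ hneg.ne] at h1
    linarith
  have hsingle : ∀ (j : Fin d) (a : ℝ), (if i = j then a else 0) ≤ 0 → 0 ≤ a * f (e j) := by
    intro j a ha
    have h1 := hQnonneg (a • e j) ⟨fun k => if k = j then a else 0, ha, by simp [ite_smul]⟩
    simpa using h1
  have hne : ∀ j, i ≠ j → f (e j) = 0 := by
    intro j hij
    have h1 := hsingle j 1 (by simp [hij])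
    have h2 := hsingle j (-1) (by simp [hij])
    linarith
  have hle : f (e i) ≤ 0 := by
    have h2 := hsingle i (-1) (by simp)
    linarith
  have hlt : f (e i) < 0 := by
    refine lt_of_le_of_ne hle fun h0 => ?_
    obtain ⟨p, hp⟩ := intrinsicInterior_convexHull_range_nonempty (v := v) hd
    obtain ⟨w, -, hw1, hwp⟩ :=
      mem_convexHull_range_iff_exists_weights.1 (intrinsicInterior_subset hp)
    have h1 := hCneg (p, 1) (mk_one_mem_coneOver.2 (hv.2.2.1 hp))
    have h2 : ((p, 1) : Euc d × ℝ) = ∑ j, w j • e j := by rw [sum_smul_mk_one, hwp, hw1]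
    rw [h2, map_sum, Finset.sum_eq_zero] at h1
    · exact lt_irrefl _ h1
    · intro j _
      rw [map_smul, smul_eq_mul]
      by_cases hij : i = j
      · rw [← hij, h0, mul_zero]
      · rw [hne j hij, mul_zero]
  refine ⟨(f (e i))⁻¹ • f, fun j => ?_, fun c hc => ?_⟩
  · change (f (e i))⁻¹ * f (e j) = _
    split_ifs with hij
    · rw [← hij, inv_mul_cancel₀ hlt.ne]
    · rw [hne j hij, mul_zero]
  · change 0 < (f (e i))⁻¹ * f c
    exact mul_pos_of_neg_of_neg (inv_lt_zero.2 hlt) (hCneg c hc)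

lemma IsFlatWith.closure_intrinsicInterior (hv : IsFlatWith Ω v) (hd : 0 < d)
    (hop : IsOpen Ω) (hconv : Convex ℝ Ω) :
    closure (intrinsicInterior ℝ (convexHull ℝ (range v))) = convexHull ℝ (range v) := by
  have hTc : IsClosed (convexHull ℝ (range v)) :=
    ((finite_range v).isCompact_convexHull ℝ).isClosed
  refine Subset.antisymm (closure_minimal intrinsicInterior_subset hTc) fun x hx => ?_
  obtain ⟨p, hp⟩ := intrinsicInterior_convexHull_range_nonempty (v := v) hd
  have hxΩ : x ∈ closure Ω := by
    by_cases hxF : x ∈ intrinsicInterior ℝ (convexHull ℝ (range v))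
    · exact subset_closure (hv.2.2.1 hxF)
    · exact (hv.2.2.2 ⟨hx, hxF⟩).1
  have hsub : openSegment ℝ p x ⊆ intrinsicInterior ℝ (convexHull ℝ (range v)) := by
    intro z hz
    refine hv.mem_intrinsicInterior_of_mem ?_ ?_
    · exact (convex_convexHull ℝ _).openSegment_subset (intrinsicInterior_subset hp) hx hz
    · have := hconv.openSegment_interior_closure_subset_interior
        (x := p) (by rw [hop.interior_eq]; exact hv.2.2.1 hp) hxΩ hz
      rwa [hop.interior_eq] at this
  refine closure_mono hsub ?_
  exact segment_subset_closure_openSegment (right_mem_segment ℝ p x)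

lemma IsFlatWith.exists_affine_functional (hv : IsFlatWith Ω v) (hd : 2 ≤ d)
    (hop : IsOpen Ω) (hconv : Convex ℝ Ω) {S : AffineSubspace ℝ (Euc d)}
    (hSle : S ≤ affineSpan ℝ (range v)) (hSne : (S : Set (Euc d)).Nonempty)
    (hSdim : Module.finrank ℝ S.direction = d - 2)
    (hSdisj : (S : Set (Euc d)) ∩ intrinsicInterior ℝ (convexHull ℝ (range v)) = ∅) :
    ∃ a : Fin d → ℝ, (∀ i, 0 ≤ a i) ∧ (∃ i, a i ≠ 0) ∧
      ∀ w : Fin d → ℝ, ∑ i, w i = 1 → (∑ i, w i • v i ∈ S ↔ ∑ i, w i * a i = 0) := by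
  obtain ⟨s₀, hs₀⟩ := hSne
  set A := affineSpan ℝ (range v) with hA
  have hAdim : Module.finrank ℝ A.direction = d - 1 := by
    rw [hA, direction_affineSpan]
    exact hv.1.finrank_vectorSpan (by simp; omega)
  have hdir : S.direction < A.direction := by
    refine lt_of_le_of_ne (AffineSubspace.direction_le hSle) fun h => ?_
    rw [h] at hSdim
    omega
  obtain ⟨u, huA, huS⟩ := SetLike.exists_of_lt hdir
  obtain ⟨g, hgu, hgS⟩ := Submodule.exists_dual_map_eq_bot_of_notMem huS inferInstance
  have hgS' : ∀ x ∈ S.direction, g x = 0 := fun x hx => by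
    have := Submodule.mem_map_of_mem (f := g) hx
    rwa [hgS, Submodule.mem_bot] at this
  have hsup : S.direction ⊔ Submodule.span ℝ {u} = A.direction := by
    refine Submodule.eq_of_le_of_finrank_le
      (sup_le hdir.le ((Submodule.span_singleton_le_iff_mem _ _).2 huA)) ?_
    have hlt : S.direction < S.direction ⊔ Submodule.span ℝ {u} :=
      lt_of_le_of_ne le_sup_left fun h => huS (by
        rw [h]
        exact Submodule.mem_sup_right (Submodule.mem_span_singleton_self u))
    have := Submodule.finrank_lt_finrank_of_lt hlt
    omega
  have hSiff : ∀ x ∈ A, x ∈ S ↔ g (x - s₀) = 0 := by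
    intro x hx
    have hxS : x ∈ S ↔ x - s₀ ∈ S.direction :=
      (AffineSubspace.vsub_right_mem_direction_iff_mem hs₀ x).symm
    rw [hxS]
    refine ⟨hgS' _, fun h0 => ?_⟩
    have hxd : x - s₀ ∈ A.direction := AffineSubspace.vsub_mem_direction hx (hSle hs₀)
    rw [← hsup] at hxd
    obtain ⟨y, hy, z, hz, hyz⟩ := Submodule.mem_sup.1 hxd
    obtain ⟨c, rfl⟩ := Submodule.mem_span_singleton.1 hz
    rw [← hyz, map_add, hgS' y hy, zero_add, map_smul, smul_eq_mul] at h0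
    have hc : c = 0 := (mul_eq_zero.1 h0).resolve_right hgu
    rw [← hyz, hc, zero_smul, add_zero]
    exact hy
  set F := intrinsicInterior ℝ (convexHull ℝ (range v)) with hF
  have hFA : ∀ x ∈ F, x ∈ A := fun x hx =>
    convexHull_subset_affineSpan _ (intrinsicInterior_subset hx)
  have hFeq : F = convexHull ℝ (range v) ∩ Ω :=
    Subset.antisymm (fun x hx => ⟨intrinsicInterior_subset hx, hv.2.2.1 hx⟩)
      fun x hx => hv.mem_intrinsicInterior_of_mem hx.1 hx.2
  have hFconv : Convex ℝ F := by
    rw [hFeq]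
    exact (convex_convexHull ℝ _).inter hconv
  have hgF : ∀ x ∈ F, g (x - s₀) ≠ 0 := fun x hx h0 => by
    have : x ∈ (S : Set (Euc d)) ∩ F := ⟨(hSiff x (hFA x hx)).2 h0, hx⟩
    rw [hSdisj] at this
    exact this
  have hgc : Continuous fun x => g (x - s₀) :=
    g.continuous_of_finiteDimensional.comp (continuous_sub_right s₀)
  obtain ⟨p, hp⟩ := intrinsicInterior_convexHull_range_nonempty (v := v) (by omega)
  obtain ⟨g', hg'S, hg'pos⟩ : ∃ g' : Euc d →ₗ[ℝ] ℝ,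
      (∀ x, g' x = 0 ↔ g x = 0) ∧ ∀ x ∈ F, 0 < g' (x - s₀) := by
    have himg := (hFconv.isPreconnected.image _ hgc.continuousOn).ordConnected
    have hno : ∀ x ∈ F, ∀ y ∈ F, g (x - s₀) < 0 → ¬ 0 < g (y - s₀) := by
      intro x hx y hy hxneg hypos
      obtain ⟨z, hz, hz0⟩ := himg.out (mem_image_of_mem _ hx) (mem_image_of_mem _ hy)
        ⟨hxneg.le, hypos.le⟩
      exact hgF z hz hz0
    rcases lt_or_gt_of_ne (hgF p hp) with h | h
    · refine ⟨-g, fun x => by simp, fun x hx => ?_⟩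
      have := (hgF x hx).lt_of_le (not_lt.1 (hno p hp x hx h))
      simpa using this
    · refine ⟨g, fun x => Iff.rfl, fun x hx => ?_⟩
      exact (hgF x hx).symm.lt_of_le (not_lt.1 fun hneg => hno x hx p hp hneg h)
  have hsum : ∀ w : Fin d → ℝ, ∑ i, w i = 1 →
      ∑ i, w i * g' (v i - s₀) = g' (∑ i, w i • v i - s₀) := by
    intro w hw
    simp only [map_sub, map_sum, map_smul, smul_eq_mul, mul_sub, Finset.sum_sub_distrib]
    rw [← Finset.sum_mul, hw, one_mul]
  refine ⟨fun i => g' (v i - s₀), fun i => ?_, ?_, fun w hw => ?_⟩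
  · have hcl : v i ∈ closure F := by
      rw [hv.closure_intrinsicInterior (by omega) hop hconv]
      exact subset_convexHull ℝ _ (mem_range_self i)
    exact closure_minimal (t := {x | 0 ≤ g' (x - s₀)}) (fun x hx => (hg'pos x hx).le)
      (isClosed_le continuous_const
        (g'.continuous_of_finiteDimensional.comp (continuous_sub_right s₀))) hcl
  · by_contra! h0
    obtain ⟨w, -, hw1, hwp⟩ :=
      mem_convexHull_range_iff_exists_weights.1 (intrinsicInterior_subset hp)
    have h1 := hg'pos p hp
    rw [← hwp, ← hsum w hw1] at h1
    simp [h0] at h1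
  · rw [hsum w hw, hg'S]
    exact hSiff _ (mem_affineSpan_range_iff_exists_weights.2 ⟨w, hw, rfl⟩)

end Flat

end Simplex

theorem face_of_flat_is_face {d : ℕ} (Ω : Set (Euc d)) (hne : Ω.Nonempty)
    (hbd : Bornology.IsBounded Ω) (hop : IsOpen Ω) (hconv : Convex ℝ Ω)
    (hd : 3 ≤ d) (hirr : IsIrreducibleDomain Ω)
    (Γ : Subgroup ((Euc d × ℝ) ≃ₗ[ℝ] (Euc d × ℝ)))
    (htf : TorsionFreeSub Γ) (hdiv : Divides Ω Γ)
    (F : Set (Euc d)) (hF : IsFlat Ω F) (K : Set (Euc d)) (hKne : K.Nonempty)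
    (S : AffineSubspace ℝ (Euc d)) (hSpan : S ≤ affineSpan ℝ F)
    (hSdim : Module.finrank ℝ S.direction = d - 2)
    (hSdisj : (S : Set (Euc d)) ∩ F = ∅)
    (hK : K = (S : Set (Euc d)) ∩ (closure F \ F)) :
    IsFace Ω K := by
  obtain ⟨v, hv, rfl⟩ := hF
  have hd0 : 0 < d := by omega
  set T := convexHull ℝ (range v) with hT
  set F := intrinsicInterior ℝ T with hF
  rw [hv.closure_intrinsicInterior hd0 hop hconv] at hK
  have hSne : (S : Set (Euc d)).Nonempty := by
    rw [hK] at hKne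
    exact hKne.mono inter_subset_left
  have hSle : S ≤ affineSpan ℝ (range v) :=
    hSpan.trans ((affineSpan_mono ℝ intrinsicInterior_subset).trans
      (affineSpan_convexHull _).le)
  obtain ⟨a, ha0, ⟨i₀, hi₀⟩, haS⟩ :=
    hv.exists_affine_functional (by omega) hop hconv hSle hSne hSdim hSdisj
  choose ℓ hℓdual hℓpos using hv.exists_dual hd0 hop hconv
  have hℓA : ∀ i, ∀ c ∈ closure (coneOver Ω), 0 ≤ ℓ i c := fun i =>
    nonneg_on_closure fun c hc => (hℓpos i c hc).le
  have hℓsum : ∀ (w : Fin d → ℝ) i, ℓ i (∑ j, w j • (v j, 1)) = w i := by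
    intro w i
    rw [map_sum]
    simp only [map_smul, hℓdual, smul_eq_mul, mul_ite, mul_one, mul_zero, Finset.sum_ite_eq,
      Finset.mem_univ, if_true]
  let Φ : Euc d × ℝ →L[ℝ] ℝ := ∑ i, a i • ℓ i
  have hΦ : ∀ z, Φ z = ∑ i, a i * ℓ i z := fun z => by simp [Φ]
  have hΦpos : ∀ c ∈ coneOver Ω, 0 < Φ c := fun c hc => by
    rw [hΦ]
    exact Finset.sum_pos' (fun i _ => mul_nonneg (ha0 i) (hℓpos i c hc).le)
      ⟨i₀, Finset.mem_univ _, mul_pos ((ha0 i₀).lt_of_ne' hi₀) (hℓpos i₀ c hc)⟩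
  have hΦK : ∀ x ∈ K, Φ (x, 1) = 0 := by
    intro x hx
    rw [hK] at hx
    obtain ⟨w, -, hw1, rfl⟩ := mem_convexHull_range_iff_exists_weights.1 hx.2.1
    have h1 := (haS w hw1).1 hx.1
    have h2 : ((∑ i, w i • v i, 1) : Euc d × ℝ) = ∑ i, w i • (v i, 1) := by
      rw [sum_smul_mk_one, hw1]
    rw [h2, hΦ, ← h1]
    exact Finset.sum_congr rfl fun i _ => by rw [hℓsum, mul_comm]
  let f : Euc d →L[ℝ] ℝ := Φ.comp (ContinuousLinearMap.inl ℝ (Euc d) ℝ)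
  have hf : ∀ x, f x = -Φ (0, 1) ↔ Φ (x, 1) = 0 := by
    intro x
    have h1 : ((x, 1) : Euc d × ℝ) = (x, 0) + (0, 1) := by simp
    rw [h1, map_add]
    exact eq_neg_iff_add_eq_zero
  refine ⟨hKne, f, -Φ (0, 1), ?_, fun y hy h => ?_, ?_⟩
  · intro hf0
    obtain ⟨x, hx⟩ := hKne
    have h1 := (hf x).2 (hΦK x hx)
    obtain ⟨y, hy⟩ := hne
    have h2 := (hf y).1 (by rw [← h1, hf0]; rfl)
    exact (hΦpos _ (mk_one_mem_coneOver.2 hy)).ne' h2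
  · exact (hΦpos _ (mk_one_mem_coneOver.2 hy)).ne' ((hf y).1 h)
  refine Subset.antisymm (fun x hx => ⟨(hf x).2 (hΦK x hx), ?_⟩) fun y hy => ?_
  · rw [hK] at hx
    exact hv.2.2.2 hx.2
  by_contra hyK
  obtain ⟨hyf, hyΩ, hyn⟩ := hy
  have hyA : ((y, 1) : Euc d × ℝ) ∈ closure (coneOver Ω) := mk_one_mem_closure_coneOver hyΩ
  have hℓy : ∀ i, a i ≠ 0 → ℓ i (y, 1) = 0 := by
    intro i hi
    have h1 := (hf y).1 hyf
    rw [hΦ, Finset.sum_eq_zero_iff_of_nonneg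
      fun j _ => mul_nonneg (ha0 j) (hℓA j _ hyA)] at h1
    exact (mul_eq_zero.1 (h1 i (Finset.mem_univ i))).resolve_left hi
  have hyspan : ((y, 1) : Euc d × ℝ) ∉
      Submodule.span ℝ (range fun i => ((v i, 1) : Euc d × ℝ)) := by
    intro hmem
    obtain ⟨w, hw⟩ := (Submodule.mem_span_range_iff_exists_fun ℝ).1 hmem
    have hw0 : ∀ i, w i = ℓ i (y, 1) := fun i => by rw [← hw, hℓsum]
    rw [sum_smul_mk_one, Prod.mk.injEq] at hw
    apply hyK
    rw [hK]
    refine ⟨?_, ?_, fun hyF => hyn (hv.2.2.1 hyF)⟩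
    · rw [← hw.1]
      refine (haS w hw.2).2 (Finset.sum_eq_zero fun i _ => ?_)
      by_cases hi : a i = 0
      · rw [hi, mul_zero]
      · rw [hw0, hℓy i hi, zero_mul]
    · exact mem_convexHull_range_iff_exists_weights.2
        ⟨w, fun i => (hℓA i _ hyA).trans_eq (hw0 i).symm, hw.2, hw.1⟩
  classical
  let ι := {i : Fin d // a i ≠ 0}
  have : Nonempty ι := ⟨⟨i₀, hi₀⟩⟩
  let e : ι → Euc d × ℝ := fun i => (v i, 1)
  let ℓ' : ι → Euc d × ℝ →L[ℝ] ℝ := fun i => ℓ i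
  have hdual : ∀ i j, ℓ' i (e j) = if i = j then 1 else 0 := fun i j => by
    by_cases hij : i = j
    · simp [ℓ', e, hℓdual, hij]
    · simp [ℓ', e, hℓdual, hij, Subtype.coe_injective.ne hij]
  have hcone := smul_mem_coneOver (Ω := Ω)
  have hCconv := convex_coneOver hconv
  have hCne : (coneOver Ω).Nonempty := hne.image (fun x => ((x, 1) : Euc d × ℝ)) |>.mono (by
    rintro _ ⟨x, hx, rfl⟩
    exact mk_one_mem_coneOver.2 hx)
  have hvA : ∀ i, ((v i, 1) : Euc d × ℝ) ∈ closure (coneOver Ω) := fun i =>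
    mk_one_mem_closure_coneOver (hv.2.1 i).1
  have hzero := zero_mem_closure_cone hcone hCne
  have hyD : ((y, 1) : Euc d × ℝ) ∈ splitCone (coneOver Ω) e ℓ' := by
    have h0 : coordProj e ℓ' (y, 1) = 0 := by
      rw [coordProj_apply]
      exact Finset.sum_eq_zero fun i _ => by rw [hℓy i i.2, zero_smul]
    refine ⟨?_, fun i => (hℓy i i.2).ge⟩
    rwa [h0, sub_zero]
  have hvD : ∀ i, ((v i, 1) : Euc d × ℝ) ∈ splitCone (coneOver Ω) e ℓ' := by
    intro i
    refine ⟨?_, fun j => hℓA j _ (hvA i)⟩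
    by_cases hi : a i = 0
    · have h0 : coordProj e ℓ' (v i, 1) = 0 := by
        rw [coordProj_apply]
        refine Finset.sum_eq_zero fun j _ => ?_
        have hji : (j : Fin d) ≠ i := fun h => j.2 (h ▸ hi)
        simp only [ℓ', hℓdual, if_neg hji, zero_smul]
      rw [h0, sub_zero]
      exact hvA i
    · have h0 : coordProj e ℓ' (v i, 1) = (v i, 1) := coordProj_self hdual ⟨i, hi⟩
      rw [h0, sub_self]
      exact hzero
  have hzD : (0 : Euc d × ℝ) ∈ splitCone (coneOver Ω) e ℓ' :=
    ⟨by simpa using hzero, fun i => by simp⟩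
  have hspan : Submodule.span ℝ (splitCone (coneOver Ω) e ℓ') = ⊤ := by
    apply Submodule.eq_top_of_finrank_eq
    have hlt : Submodule.span ℝ (range fun i => ((v i, 1) : Euc d × ℝ)) <
        Submodule.span ℝ (splitCone (coneOver Ω) e ℓ') := by
      refine lt_of_le_of_ne (Submodule.span_mono (range_subset_iff.2 hvD)) fun h => hyspan ?_
      rw [h]
      exact Submodule.subset_span hyD
    have h1 := Submodule.finrank_lt_finrank_of_lt hlt
    rw [finrank_span_eq_card hv.1.linearIndependent_mk_one, Fintype.card_fin] at h1
    have h2 := (Submodule.span ℝ (splitCone (coneOver Ω) e ℓ')).finrank_le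
    have h3 : Module.finrank ℝ (Euc d × ℝ) = d + 1 := by simp
    omega
  obtain ⟨p, hp⟩ : (interior (splitCone (coneOver Ω) e ℓ')).Nonempty := by
    rw [(convex_splitCone hCconv).interior_nonempty_iff_affineSpan_eq_top,
      AffineSubspace.affineSpan_eq_top_iff_vectorSpan_eq_top_of_nonempty ℝ _ _ ⟨0, hzD⟩,
      vectorSpan_eq_span_vsub_set_right ℝ hzD]
    simpa using hspan
  obtain ⟨m, hm⟩ := exists_norm_le_on_coneOver hbd
  obtain ⟨D, hD, hDC, hco⟩ := hdiv.exists_compact_cone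
  obtain ⟨h, hh⟩ := exists_equiv_image_interior_splitCone (isOpen_coneOver hop) hCconv hcone hCne
    hm hdual (fun i => hvA i) (fun i c hc => (hℓpos i c hc).le) hp hD hDC hco
  exact not_isIrreducibleDomain_of_splitCone hCconv hcone hdual (y := (y, 1)) (by simp)
    (fun i => hℓy i i.2) h hh hirr
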